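/- (Stein characterization of the GIG distribution: necessity.) Let p ∈ ℝ, a, b > 0, and let f_{p,a,b} denote the GIG(p, a, b) density. Let X be a random variable that is positive almost surely and such that for every differentiable function h : (0, ∞) → ℝ satisfying lim_{x→∞} f_{p,a,b}(x)·h(x) = 0 and lim_{x→0⁺} f_{p,a,b}(x)·h(x) = 0, and such that x ↦ h′(x) + ((p−1)/x + b/(2x²) − a/2)·h(x) is integrable with respect to the law of X, one has E[h′(X) + ((p−1)/X + b/(2X²) − a/2)·h(X)] = 0. Then X follows the GIG(p, a, b) distribution. -/

import Mathlib

open MeasureTheory ProbabilityTheory Real Set Filter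

/-- Unnormalized density of the GIG(p, a, b) distribution on (0, ∞). -/
noncomputable def gigpdf (p a b : ℝ) (x : ℝ) : ℝ :=
  if 0 < x then x ^ (p - 1) * Real.exp (-(a * x + b / x) / 2) else 0

/-- The normalized GIG(p, a, b) density `f_{p,a,b}`. -/
noncomputable def gigpdfN (p a b : ℝ) (x : ℝ) : ℝ :=
  gigpdf p a b x / ∫ t in Set.Ioi (0 : ℝ), gigpdf p a b t

lemma gigpdf_of_pos (p a b : ℝ) {x : ℝ} (hx : 0 < x) :
    gigpdf p a b x = x ^ (p - 1) * Real.exp (-(a * x + b / x) / 2) := if_pos hx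

lemma gigpdf_of_nonpos (p a b : ℝ) {x : ℝ} (hx : x ≤ 0) : gigpdf p a b x = 0 :=
  if_neg hx.not_gt

lemma gigpdf_pos (p a b : ℝ) {x : ℝ} (hx : 0 < x) : 0 < gigpdf p a b x := by
  rw [gigpdf_of_pos p a b hx]
  positivity

lemma gigpdf_nonneg (p a b x : ℝ) : 0 ≤ gigpdf p a b x := by
  rcases le_or_gt x 0 with hx | hx
  · exact (gigpdf_of_nonpos p a b hx).ge
  · exact (gigpdf_pos p a b hx).le

@[fun_prop]
lemma measurable_gigpdf (p a b : ℝ) : Measurable (gigpdf p a b) := by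
  unfold gigpdf
  exact Measurable.ite measurableSet_Ioi (by fun_prop) measurable_const

lemma hasDerivAt_gigpdf (p a b : ℝ) {x : ℝ} (hx : 0 < x) :
    HasDerivAt (gigpdf p a b)
      (gigpdf p a b x * ((p - 1) / x + b / (2 * x ^ 2) - a / 2)) x := by
  have heq : gigpdf p a b =ᶠ[nhds x]
      fun y => y ^ (p - 1) * Real.exp (-(a * y + b / y) / 2) := by
    filter_upwards [Ioi_mem_nhds hx] with y hy using gigpdf_of_pos p a b hy
  have h1 : HasDerivAt (fun y : ℝ => y ^ (p - 1)) ((p - 1) * x ^ (p - 1 - 1)) x :=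
    Real.hasDerivAt_rpow_const (Or.inl hx.ne')
  have h2 : HasDerivAt (fun y : ℝ => -(a * y + b / y) / 2)
      (-(a * 1 + (0 * x - b * 1) / x ^ 2) / 2) x :=
    ((((hasDerivAt_id x).const_mul a).add
      ((hasDerivAt_const x b).div (hasDerivAt_id x) hx.ne')).neg).div_const 2
  refine ((h1.mul h2.exp).congr_of_eventuallyEq heq).congr_deriv ?_
  rw [gigpdf_of_pos p a b hx, Real.rpow_sub_one hx.ne' (p - 1)]
  field_simp
  ring

lemma integrable_gigpdf (p : ℝ) {a b : ℝ} (ha : 0 < a) (hb : 0 < b) :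
    Integrable (gigpdf p a b) := by
  obtain ⟨n, hn⟩ := exists_nat_gt (-p)
  have hdom : IntegrableOn
      (fun x : ℝ => ((n.factorial : ℝ) / (b / 2) ^ n) *
        (x ^ (p - 1 + n) * Real.exp (-(a / 2) * x ^ (1 : ℝ)))) (Ioi 0) :=
    (integrableOn_rpow_mul_exp_neg_mul_rpow (by linarith) one_pos (half_pos ha)).const_mul _
  have hon : IntegrableOn (gigpdf p a b) (Ioi 0) := by
    refine Integrable.mono' hdom (measurable_gigpdf p a b).aestronglyMeasurable ?_
    filter_upwards [ae_restrict_mem measurableSet_Ioi] with x (hx : 0 < x)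
    rw [Real.norm_of_nonneg (gigpdf_nonneg p a b x), gigpdf_of_pos p a b hx, Real.rpow_one,
      Real.rpow_add_natCast hx.ne']
    have hy : 0 < b / 2 / x := by positivity
    have hexp : Real.exp (-(b / 2 / x)) ≤ n.factorial / (b / 2 / x) ^ n := by
      rw [Real.exp_neg, inv_le_comm₀ (Real.exp_pos _) (by positivity), inv_div]
      exact Real.pow_div_factorial_le_exp _ hy.le n
    have hsplit : Real.exp (-(a * x + b / x) / 2)
        = Real.exp (-(a / 2) * x) * Real.exp (-(b / 2 / x)) := by
      rw [← Real.exp_add]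
      congr 1
      ring
    rw [hsplit]
    calc x ^ (p - 1) * (Real.exp (-(a / 2) * x) * Real.exp (-(b / 2 / x)))
        ≤ x ^ (p - 1) * (Real.exp (-(a / 2) * x) * (n.factorial / (b / 2 / x) ^ n)) := by
          gcongr
      _ = _ := by
          rw [div_pow (b / 2) x]
          field_simp
  refine (integrableOn_iff_integrable_of_support_subset fun x hx => ?_).1 hon
  by_contra hx'
  exact hx (gigpdf_of_nonpos p a b (not_lt.1 hx'))

lemma setIntegral_gigpdf_pos (p : ℝ) {a b : ℝ} (ha : 0 < a) (hb : 0 < b) :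
    0 < ∫ t in Ioi (0 : ℝ), gigpdf p a b t := by
  rw [setIntegral_pos_iff_support_of_nonneg_ae
    (Eventually.of_forall (gigpdf_nonneg p a b)) (integrable_gigpdf p ha hb).integrableOn]
  have hsub : Ioi (0 : ℝ) ⊆ Function.support (gigpdf p a b) ∩ Ioi 0 :=
    fun x hx => ⟨(gigpdf_pos p a b hx).ne', hx⟩
  exact lt_of_lt_of_le (by simp) (measure_mono hsub)

lemma gigpdfN_nonneg (p a b x : ℝ) : 0 ≤ gigpdfN p a b x :=
  div_nonneg (gigpdf_nonneg p a b x) (integral_nonneg (gigpdf_nonneg p a b))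

lemma gigpdfN_pos (p : ℝ) {a b x : ℝ} (ha : 0 < a) (hb : 0 < b) (hx : 0 < x) :
    0 < gigpdfN p a b x :=
  div_pos (gigpdf_pos p a b hx) (setIntegral_gigpdf_pos p ha hb)

lemma gigpdfN_of_nonpos (p a b : ℝ) {x : ℝ} (hx : x ≤ 0) : gigpdfN p a b x = 0 := by
  rw [gigpdfN, gigpdf_of_nonpos p a b hx, zero_div]

@[fun_prop]
lemma measurable_gigpdfN (p a b : ℝ) : Measurable (gigpdfN p a b) :=
  (measurable_gigpdf p a b).div_const _

lemma integrable_gigpdfN (p : ℝ) {a b : ℝ} (ha : 0 < a) (hb : 0 < b) :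
    Integrable (gigpdfN p a b) :=
  (integrable_gigpdf p ha hb).div_const _

lemma hasDerivAt_gigpdfN (p a b : ℝ) {x : ℝ} (hx : 0 < x) :
    HasDerivAt (gigpdfN p a b)
      (gigpdfN p a b x * ((p - 1) / x + b / (2 * x ^ 2) - a / 2)) x := by
  refine ((hasDerivAt_gigpdf p a b hx).div_const _).congr_deriv ?_
  rw [gigpdfN]
  ring

lemma setIntegral_gigpdfN (p : ℝ) {a b : ℝ} (ha : 0 < a) (hb : 0 < b) :
    ∫ t in Ioi (0 : ℝ), gigpdfN p a b t = 1 := by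
  simp only [gigpdfN, integral_div]
  exact div_self (setIntegral_gigpdf_pos p ha hb).ne'

lemma integral_withDensity_gigpdfN (p a b : ℝ) (g : ℝ → ℝ) :
    ∫ x, g x ∂volume.withDensity (fun x => ENNReal.ofReal (gigpdfN p a b x))
      = ∫ x in Ioi (0 : ℝ), gigpdfN p a b x * g x := by
  rw [integral_withDensity_eq_integral_toReal_smul (by fun_prop)
    (Eventually.of_forall fun _ => ENNReal.ofReal_lt_top)]
  simp only [ENNReal.toReal_ofReal (gigpdfN_nonneg p a b _), smul_eq_mul]
  refine (setIntegral_eq_integral_of_forall_compl_eq_zero fun x hx => ?_).symm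
  rw [gigpdfN_of_nonpos p a b (not_lt.1 hx), zero_mul]

/-- The GIG Stein equation `h' + ((p - 1)/x + b/(2x²) - a/2) h = g` is solvable for bounded
continuous `g` of GIG-mean zero, with `f_{p,a,b}·h` vanishing at `0⁺` and `∞`. -/
lemma exists_gig_stein_solution (p : ℝ) {a b : ℝ} (ha : 0 < a) (hb : 0 < b)
    {g : ℝ → ℝ} (hg : Continuous g) {C : ℝ} (hC : ∀ x, ‖g x‖ ≤ C)
    (hmean : ∫ x in Ioi (0 : ℝ), gigpdfN p a b x * g x = 0) :
    ∃ h : ℝ → ℝ,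
      (∀ x ∈ Ioi (0 : ℝ),
        HasDerivAt h (g x - ((p - 1) / x + b / (2 * x ^ 2) - a / 2) * h x) x) ∧
      Tendsto (fun x => gigpdfN p a b x * h x) atTop (nhds 0) ∧
      Tendsto (fun x => gigpdfN p a b x * h x) (nhdsWithin 0 (Ioi 0)) (nhds 0) := by
  set f := gigpdfN p a b with hf
  have hint : Integrable (fun x => f x * g x) :=
    (integrable_gigpdfN p ha hb).mul_bdd hg.aestronglyMeasurable (Eventually.of_forall hC)
  set G : ℝ → ℝ := fun x => ∫ t in (0 : ℝ)..x, f t * g t with hG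
  have hcancel : ∀ x, 0 < x → f x * (G x / f x) = G x := fun x hx =>
    mul_div_cancel₀ _ (gigpdfN_pos p ha hb hx).ne'
  refine ⟨fun x => G x / f x, fun x (hx : 0 < x) => ?_, ?_, ?_⟩
  · have hfx : f x ≠ 0 := (gigpdfN_pos p ha hb hx).ne'
    have hfd := hasDerivAt_gigpdfN p a b hx
    have hGd : HasDerivAt G (f x * g x) x :=
      intervalIntegral.integral_hasDerivAt_right hint.intervalIntegrable
        (hint.aestronglyMeasurable.stronglyMeasurableAtFilter)
        (hfd.continuousAt.mul hg.continuousAt)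
    refine (hGd.div hfd hfx).congr_deriv ?_
    rw [← hf]
    field_simp
  · have hlim := intervalIntegral_tendsto_integral_Ioi (0 : ℝ) hint.integrableOn tendsto_id
    rw [hmean] at hlim
    refine hlim.congr' ?_
    filter_upwards [eventually_gt_atTop 0] with x hx using (hcancel x hx).symm
  · have hcont : Continuous G :=
      intervalIntegral.continuous_primitive (fun _ _ => hint.intervalIntegrable) 0
    have hlim : Tendsto G (nhdsWithin 0 (Ioi 0)) (nhds 0) := by
      have h0 : G 0 = 0 := intervalIntegral.integral_same
      simpa only [h0] using (hcont.tendsto 0).mono_left nhdsWithin_le_nhds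
    refine hlim.congr' ?_
    filter_upwards [self_mem_nhdsWithin] with x hx using (hcancel x hx).symm

/-- Stein characterization of the GIG distribution (necessity): if a positive random
variable `X` satisfies `E[h'(X) + ((p-1)/X + b/(2X²) - a/2) h(X)] = 0` for every
differentiable `h` such that `f_{p,a,b}·h` vanishes at `0⁺` and `∞` and the Stein operator
applied to `h` is integrable with respect to the law of `X`, then `X ~ GIG(p, a, b)`. -/
theorem gig_stein_characterization
    {Ω : Type*} [MeasurableSpace Ω] (μ : Measure Ω) [IsProbabilityMeasure μ]
    (p a b : ℝ) (ha : 0 < a) (hb : 0 < b)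
    (X : Ω → ℝ) (hXm : Measurable X) (hXpos : ∀ᵐ ω ∂μ, 0 < X ω)
    (hstein : ∀ h h' : ℝ → ℝ,
      (∀ x ∈ Set.Ioi (0 : ℝ), HasDerivAt h (h' x) x) →
      Tendsto (fun x => gigpdfN p a b x * h x) atTop (nhds 0) →
      Tendsto (fun x => gigpdfN p a b x * h x) (nhdsWithin 0 (Set.Ioi 0)) (nhds 0) →
      Integrable
        (fun ω => h' (X ω) + ((p - 1) / X ω + b / (2 * X ω ^ 2) - a / 2) * h (X ω)) μ →
      ∫ ω, (h' (X ω) + ((p - 1) / X ω + b / (2 * X ω ^ 2) - a / 2) * h (X ω)) ∂μ = 0) :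
    Measure.map X μ = volume.withDensity (fun x => ENNReal.ofReal (gigpdfN p a b x)) := by
  have hfi := integrable_gigpdfN p ha hb
  have : IsFiniteMeasure (volume.withDensity (fun x => ENNReal.ofReal (gigpdfN p a b x))) :=
    isFiniteMeasure_withDensity_ofReal hfi.2
  have : IsProbabilityMeasure (Measure.map X μ) :=
    Measure.isProbabilityMeasure_map hXm.aemeasurable
  refine ext_of_forall_integral_eq_of_IsFiniteMeasure fun g => ?_
  rw [integral_withDensity_gigpdfN, integral_map hXm.aemeasurable
    g.continuous.aestronglyMeasurable]
  set c := ∫ x in Ioi (0 : ℝ), gigpdfN p a b x * g x with hc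
  have hmean : ∫ x in Ioi (0 : ℝ), gigpdfN p a b x * (g x - c) = 0 := by
    simp only [mul_sub]
    rw [integral_sub (hfi.mul_bdd g.continuous.aestronglyMeasurable
        (Eventually.of_forall g.norm_coe_le_norm)).integrableOn
      (hfi.mul_const c).integrableOn, integral_mul_const, setIntegral_gigpdfN p ha hb,
      one_mul, ← hc, sub_self]
  obtain ⟨h, hderiv, htop, hzero⟩ := exists_gig_stein_solution p ha hb
    (g := fun x => g x - c) (by fun_prop) (C := ‖g‖ + ‖c‖)
    (fun x => (norm_sub_le _ _).trans (by gcongr; exact g.norm_coe_le_norm x)) hmean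
  have hgX : Integrable (fun ω => g (X ω)) μ :=
    Integrable.of_bound (g.continuous.measurable.comp hXm).aestronglyMeasurable ‖g‖
      (Eventually.of_forall fun ω => g.norm_coe_le_norm (X ω))
  have hE := hstein h _ hderiv htop hzero
  simp only [sub_add_cancel] at hE
  have hE' := hE (hgX.sub (integrable_const c))
  rw [integral_sub hgX (integrable_const c)] at hE'
  simpa [sub_eq_zero] using hE'
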